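/- arXiv:2505.09589 — 5 statements merged into one kernel-verified Lean document; each statement's English description precedes it below -/
import Mathlib

section
/- Under Setup (★) with a chosen indexing I, for every x ∈ X and every σ ∈ G the multiplicity of the maximal ideal σ(𝔄) in the prime factorization of the ideal I(x)·𝒪_L equals v_𝔄(q)·w(σ⁻¹ x); moreover every maximal ideal of 𝒪_L dividing I(x)·𝒪_L lies over p. (In the paper's notation: inf ∘ div_A = k·Φ_ρ with k = v_𝔄(q).) -/
open scoped BigOperators

namespace PaperAux

/-- The symbol set `X_{2g}`, modeled as `Fin g ⊕ Fin g`. -/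
abbrev X (g : ℕ) := Fin g ⊕ Fin g

/-- The complex conjugation involution `c`, swapping `i` and `ī`. -/
def conjPerm (g : ℕ) : Equiv.Perm (X g) := Equiv.sumComm (Fin g) (Fin g)

/-- The group `W_{2g}`: the centralizer of `c` in `Sym(X_{2g})`. -/
def Wgrp (g : ℕ) : Subgroup (Equiv.Perm (X g)) := Subgroup.centralizer {conjPerm g}

/-- `w` is a weight function. -/
structure IsWeightFn (g : ℕ) (w : X g → ℚ) : Prop where
  nonneg : ∀ x, 0 ≤ w x
  add_one : ∀ i : Fin g, w (Sum.inl i) + w (Sum.inr i) = 1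
  mono : ∀ i j : Fin g, i ≤ j → w (Sum.inl i) ≤ w (Sum.inl j)
  den_dvd : ∀ s : ℚ, s.den ∣ (Finset.univ.filter fun x => w x = s).card

/-- The map `Φ_ρ : X → MonoidAlgebra ℚ G`,
`Φ_ρ(x) = ∑_{σ ∈ G} w(σ⁻¹ x) • (σ : MonoidAlgebra ℚ G)`. -/
noncomputable def Phi {g : ℕ} (w : X g → ℚ) (G : Subgroup (Equiv.Perm (X g))) (x : X g) :
    MonoidAlgebra ℚ G :=
  ∑ᶠ σ : G, w (((σ : Equiv.Perm (X g))⁻¹) x) • MonoidAlgebra.of ℚ G σ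

/-- The sum `∑_{σ ∈ G} σ` in the group algebra. -/
noncomputable def allSum {g : ℕ} (G : Subgroup (Equiv.Perm (X g))) : MonoidAlgebra ℚ G :=
  ∑ᶠ σ : G, MonoidAlgebra.of ℚ G σ

/-- `ρ = (w, G)` is geometrically simple (with base point `x₀ = Sum.inl 0`):
the stabilizer of `Φ_ρ(x₀)` under left multiplication equals the stabilizer of `x₀`. -/
def GeomSimple {g : ℕ} (w : X g → ℚ) (G : Subgroup (Equiv.Perm (X g))) (x₀ : X g) : Prop :=
  ∀ σ : G, MonoidAlgebra.of ℚ G σ * Phi w G x₀ = Phi w G x₀ ↔ (σ : Equiv.Perm (X g)) x₀ = x₀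

/-- The exceptionality identity for a pair of disjoint subsets `T⁺, T⁻ ⊆ Fin g`. -/
def ExcId {g : ℕ} (w : X g → ℚ) (G : Subgroup (Equiv.Perm (X g)))
    (Tp Tm : Finset (Fin g)) : Prop :=
  (∑ i ∈ Tp, Phi w G (Sum.inl i)) - (∑ j ∈ Tm, Phi w G (Sum.inl j))
    = (((Tp.card : ℚ) - (Tm.card : ℚ)) / 2) • allSum G

/-- `ρ = (w, G)` is exceptional. -/
def IsExceptional {g : ℕ} (w : X g → ℚ) (G : Subgroup (Equiv.Perm (X g))) : Prop :=
  ∃ Tp Tm : Finset (Fin g), Disjoint Tp Tm ∧ (Tp ∪ Tm).Nonempty ∧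
    Even (Tp.card + Tm.card) ∧ ExcId w G Tp Tm

/-- The induced map `σ⁺ : Fin g → Fin g` of `σ ∈ W`. -/
def plusFun {g : ℕ} (σ : Equiv.Perm (X g)) (i : Fin g) : Fin g :=
  Sum.elim id id (σ (Sum.inl i))

/-- The level set equivalence relation on `Fin g`. -/
def levelRel {g : ℕ} (G : Subgroup (Equiv.Perm (X g))) (i j : Fin g) : Prop :=
  ∀ γ ∈ G, (∀ k, plusFun γ k = k) →
    ((γ (Sum.inl i) = Sum.inr i) ↔ (γ (Sum.inl j) = Sum.inr j))

/-- The level set partition, as a setoid. -/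
def levelSetoid {g : ℕ} (G : Subgroup (Equiv.Perm (X g))) : Setoid (Fin g) where
  r := levelRel G
  iseqv := ⟨fun _ _ _ _ => Iff.rfl,
            fun h γ hγ h2 => (h γ hγ h2).symm,
            fun h1 h2 γ hγ h3 => (h1 γ hγ h3).trans (h2 γ hγ h3)⟩

/-- `m`: the number of classes of the level set partition. -/
noncomputable def numLevels {g : ℕ} (G : Subgroup (Equiv.Perm (X g))) : ℕ :=
  Nat.card (Quotient (levelSetoid G))

/-- The angle rank `δ_ρ` of a weighted permutation representation. -/
noncomputable def angleRank {g : ℕ} (w : X g → ℚ) (G : Subgroup (Equiv.Perm (X g))) : ℕ :=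
  Module.finrank ℚ (Submodule.span ℚ (Set.range (Phi w G))) - 1

end PaperAux
open NumberField

open scoped Classical in
/-- The multiplicity of a (maximal) ideal `P` in the unique factorization of a nonzero
ideal `I` of a Dedekind domain. -/
noncomputable def multIdx {R : Type*} [CommRing R] [IsDedekindDomain R]
    (P I : Ideal R) : ℕ :=
  Multiset.count P (UniqueFactorizationMonoid.normalizedFactors I)

open PaperAux Polynomial

/-- Ring isomorphisms preserve the multiplicity of a maximal ideal in the factorization. -/
theorem multIdx_map_ringEquiv {R S : Type*} [CommRing R] [IsDedekindDomain R]
    [CommRing S] [IsDedekindDomain S] (e : R ≃+* S) {P J : Ideal R}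
    (hPmax : P.IsMaximal) (hP : P ≠ ⊥) (hJ : J ≠ ⊥) :
    multIdx (Ideal.map e P) (Ideal.map e J) = multIdx P J := by
  classical
  have hle : ∀ A B : Ideal R, Ideal.map e A ≤ Ideal.map e B ↔ A ≤ B := fun A B => by
    rw [Ideal.map_le_iff_le_comap, Ideal.comap_map_of_bijective e e.bijective]
  have hbot : ∀ A : Ideal R, A ≠ ⊥ → Ideal.map e A ≠ ⊥ := fun A hA h =>
    hA ((Ideal.map_eq_bot_iff_of_injective e.injective).mp h)
  have hmax : (Ideal.map e P).IsMaximal := Ideal.map_isMaximal_of_equiv e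
  have hmult : emultiplicity (Ideal.map e P) (Ideal.map e J) = emultiplicity P J := by
    rw [emultiplicity_eq_emultiplicity_iff]
    intro n
    rw [← Ideal.map_pow, Ideal.dvd_iff_le, Ideal.dvd_iff_le, hle]
  rw [UniqueFactorizationMonoid.emultiplicity_eq_count_normalizedFactors
      (Ideal.prime_of_isPrime (hbot P hP) hmax.isPrime).irreducible (hbot J hJ),
    UniqueFactorizationMonoid.emultiplicity_eq_count_normalizedFactors
      (Ideal.prime_of_isPrime hP hPmax.isPrime).irreducible hJ,
    normalize_eq, normalize_eq] at hmult
  unfold multIdx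
  convert Nat.cast_injective hmult

/-- A maximal ideal containing a nonzero ideal divides it with nonzero multiplicity. -/
theorem multIdx_ne_zero {R : Type*} [CommRing R] [IsDedekindDomain R] {P J : Ideal R}
    (hPmax : P.IsMaximal) (hJ : J ≠ ⊥) (hJP : J ≤ P) : multIdx P J ≠ 0 := by
  classical
  unfold multIdx
  rw [Multiset.count_ne_zero, Ideal.mem_normalizedFactors_iff hJ]
  exact ⟨hPmax.isPrime, hJP⟩

/-- under Setup (★) with an indexing `I`, for every `x ∈ X` and `σ ∈ G` the
multiplicity of `σ(𝔄)` in `I(x)·𝒪_L` is `v_𝔄(q)·w(σ⁻¹ x)` (where `w = v ∘ I`), and every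
maximal ideal dividing `I(x)·𝒪_L` lies over `p`. -/
theorem div_eq_k_mul_Phi
    (g p k₀ : ℕ) (hp : p.Prime) (hk₀ : 1 ≤ k₀)
    (K : Type*) [Field K] [NumberField K]
    (hdeg : Module.finrank ℚ K = 2 * g)
    (τ : K ≃ₐ[ℚ] K) (hτ : ∀ (ι : K →+* ℂ) (y : K), ι (τ y) = starRingEnd ℂ (ι y))
    (π : 𝓞 K)
    (hπweil : ∀ ι : K →+* ℂ, ‖ι (π : K)‖ = Real.sqrt ((p : ℝ) ^ k₀))
    (hπgen : IntermediateField.adjoin ℚ {(π : K)} = ⊤)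
    (L : Type*) [Field L] [NumberField L] [Algebra K L] [IsScalarTower ℚ K L]
    [IsGalois ℚ L]
    (hcardR : Nat.card ((minpoly ℚ (π : K)).rootSet L) = 2 * g)
    (htransR : ∀ r s : L, r ∈ (minpoly ℚ (π : K)).rootSet L →
      s ∈ (minpoly ℚ (π : K)).rootSet L → ∃ σ : L ≃ₐ[ℚ] L, σ r = s)
    (𝔄 : Ideal (𝓞 L)) (h𝔄max : 𝔄.IsMaximal) (h𝔄p : (p : 𝓞 L) ∈ 𝔄)
    -- the indexing `I : X → R` (with values taken in `𝒪_L`, as all roots are integral)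
    (I : X g → 𝓞 L)
    (hIroot : ∀ x : X g, ((I x : L)) ∈ (minpoly ℚ (π : K)).rootSet L)
    (hIbij : ∀ r : L, r ∈ (minpoly ℚ (π : K)).rootSet L → ∃! x : X g, (I x : L) = r)
    (hIconj : ∀ i : Fin g, (I (Sum.inl i) : L) * (I (Sum.inr i) : L) = (p : L) ^ k₀)
    (hImono : ∀ i j : Fin g, i ≤ j →
      multIdx 𝔄 (Ideal.span {I (Sum.inl i)}) ≤ multIdx 𝔄 (Ideal.span {I (Sum.inl j)}) ∧
      2 * multIdx 𝔄 (Ideal.span {I (Sum.inl j)}) ≤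
        multIdx 𝔄 (Ideal.span {(p : 𝓞 L) ^ k₀}))
    -- the `G`-action on `R` transported to `X` through the indexing `I`
    (θ : (L ≃ₐ[ℚ] L) →* Equiv.Perm (X g)) (hθinj : Function.Injective θ)
    (hθcomp : ∀ (σ : L ≃ₐ[ℚ] L) (x : X g), (I (θ σ x) : L) = σ (I x : L))
    (hθW : θ.range ≤ Wgrp g) (hθc : conjPerm g ∈ θ.range)
    (hθtrans : ∀ x y : X g, ∃ σ' ∈ θ.range, σ' x = y)
    (x : X g) (σ : L ≃ₐ[ℚ] L) :
    ((multIdx (Ideal.map (galRestrict ℤ ℚ L (𝓞 L) σ) 𝔄) (Ideal.span {I x}) : ℚ) =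
      (multIdx 𝔄 (Ideal.span {(p : 𝓞 L) ^ k₀}) : ℚ) *
        ((multIdx 𝔄 (Ideal.span {I (θ σ⁻¹ x)}) : ℚ) /
          (multIdx 𝔄 (Ideal.span {(p : 𝓞 L) ^ k₀}) : ℚ))) ∧
    (∀ P : Ideal (𝓞 L), P.IsMaximal → Ideal.span {I x} ≤ P → (p : 𝓞 L) ∈ P) := by
  have hp0 : (p : 𝓞 L) ≠ 0 := Nat.cast_ne_zero.mpr hp.ne_zero
  have hq0 : (p : 𝓞 L) ^ k₀ ≠ 0 := pow_ne_zero _ hp0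
  have hconj : ∀ y : X g, ∃ z : X g, I y * I z = (p : 𝓞 L) ^ k₀ := by
    have hinl : ∀ i : Fin g, I (Sum.inl i) * I (Sum.inr i) = (p : 𝓞 L) ^ k₀ := fun i =>
      RingOfIntegers.ext (by simpa using hIconj i)
    rintro (i | i)
    · exact ⟨_, hinl i⟩
    · exact ⟨Sum.inl i, by rw [mul_comm, hinl i]⟩
  have hI0 : ∀ y : X g, I y ≠ 0 := fun y hy => by
    obtain ⟨z, hz⟩ := hconj y
    exact hq0 (by rw [← hz, hy, zero_mul])
  have h𝔄0 : 𝔄 ≠ ⊥ := by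
    rintro rfl
    exact hp0 h𝔄p
  constructor
  · have hk : (multIdx 𝔄 (Ideal.span {(p : 𝓞 L) ^ k₀}) : ℚ) ≠ 0 := by
      refine Nat.cast_ne_zero.mpr (multIdx_ne_zero h𝔄max ?_ ?_)
      · rwa [Ne, Ideal.span_singleton_eq_bot]
      · rw [Ideal.span_singleton_le_iff_mem]
        exact Ideal.pow_mem_of_mem _ h𝔄p _ hk₀
    rw [mul_div_cancel₀ _ hk, Nat.cast_inj]
    have hgal : galRestrict ℤ ℚ L (𝓞 L) σ (I (θ σ⁻¹ x)) = I x := by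
      apply RingOfIntegers.ext
      have h := algebraMap_galRestrict_apply (A := ℤ) (K := ℚ) (L := L) (B := 𝓞 L) σ (I (θ σ⁻¹ x))
      refine h.trans ?_
      rw [← hθcomp, ← Equiv.Perm.mul_apply, ← map_mul, mul_inv_cancel, map_one,
        Equiv.Perm.one_apply]
    have h := multIdx_map_ringEquiv (galRestrict ℤ ℚ L (𝓞 L) σ).toRingEquiv h𝔄max h𝔄0
      (J := Ideal.span {I (θ σ⁻¹ x)}) (by simpa using hI0 _)
    rw [← h, Ideal.map_span, Set.image_singleton]
    exact congrArg (fun a => multIdx _ (Ideal.span {a})) hgal.symm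
  · intro P hPmax hP
    obtain ⟨z, hz⟩ := hconj x
    refine hPmax.isPrime.mem_of_pow_mem k₀ ?_
    rw [← hz]
    exact P.mul_mem_right _ (hP (Ideal.mem_span_singleton_self _))
end

section
/- Let ρ = (w, G) be a weighted permutation representation that is not supersingular. Let m be the number of classes of the level set partition, and suppose m divides g and g/m is a prime number. Then the angle rank satisfies δ_ρ ∈ {m, g − m, g}. -/
open scoped BigOperators

section LinearAlgebra

open Polynomial Module

theorem natDegree_dvd_finrank_of_aeval_eq_zero {F E : Type*} [Field F] [AddCommGroup E] [Module F E]
    {q : F[X]} (hq : Irreducible q) (T : End F E) (hT : aeval T q = 0) :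
    q.natDegree ∣ finrank F E := by
  have : Fact (Irreducible q) := ⟨hq⟩
  let φ : AdjoinRoot q →ₐ[F] End F E := Ideal.Quotient.liftₐ (Ideal.span {q}) (aeval T) fun a ha => by
    obtain ⟨r, rfl⟩ := Ideal.mem_span_singleton'.mp ha
    rw [map_mul, hT, mul_zero]
  let : Module (AdjoinRoot q) E := Module.compHom E φ.toRingHom
  have : IsScalarTower F (AdjoinRoot q) E := ⟨fun a b x => by
    change φ (a • b) x = a • φ b x
    simp⟩
  rw [← Module.finrank_mul_finrank F (AdjoinRoot q) E,
    (AdjoinRoot.powerBasis hq.ne_zero).finrank, AdjoinRoot.powerBasis_dim hq.ne_zero]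
  exact dvd_mul_right _ _

theorem finrank_eq_finrank_ker_add_mul {p : ℕ} (hp : p.Prime) {E : Type*} [AddCommGroup E]
    [Module ℚ E] [FiniteDimensional ℚ E] (T : End ℚ E) (hT : T ^ p = 1) :
    ∃ b, finrank ℚ E = finrank ℚ (LinearMap.ker (T - 1)) + (p - 1) * b ∧ (T ≠ 1 → b ≠ 0) := by
  have : Fact p.Prime := ⟨hp⟩
  set R := LinearMap.range (T - 1)
  have hR : ∀ x ∈ R, T x ∈ R := by
    rintro _ ⟨y, rfl⟩
    exact ⟨T y, by simp⟩
  have hann : aeval (T.restrict hR) (cyclotomic p ℚ) = 0 := by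
    have h0 : aeval T (cyclotomic p ℚ) * (T - 1) = 0 := by
      have := congrArg (aeval T) (cyclotomic_prime_mul_X_sub_one ℚ p)
      simpa [hT] using this
    have hcomp : ∀ (f : ℚ[X]) (x : R), (aeval (T.restrict hR) f x : E) = aeval T f x := by
      intro f x
      induction f using Polynomial.induction_on' with
      | add f g hf hg => simp [hf, hg]
      | monomial n a =>
        rw [aeval_monomial, aeval_monomial, Module.End.pow_restrict]
        rfl
    ext ⟨_, y, rfl⟩
    rw [hcomp]
    exact LinearMap.congr_fun h0 y
  obtain ⟨b, hb⟩ := natDegree_dvd_finrank_of_aeval_eq_zero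
    (cyclotomic.irreducible_rat hp.pos) _ hann
  rw [natDegree_cyclotomic, Nat.totient_prime hp] at hb
  refine ⟨b, ?_, ?_⟩
  · rw [← hb, add_comm]
    exact (LinearMap.finrank_range_add_finrank_ker _).symm
  · rintro h rfl
    rw [mul_zero, Submodule.finrank_eq_zero, LinearMap.range_eq_bot] at hb
    exact h (sub_eq_zero.mp hb)

theorem finrank_mem_of_pow_prime_eq_one {p : ℕ} (hp : p.Prime) (h2 : p ≠ 2) {E : Type*}
    [AddCommGroup E] [Module ℚ E] (hE : finrank ℚ E = p) (T : End ℚ E)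
    (hT : T ^ p = 1) (hT1 : T ≠ 1) (U : Submodule ℚ E) (hU : ∀ x ∈ U, T x ∈ U) :
    finrank ℚ U = 0 ∨ finrank ℚ U = 1 ∨ finrank ℚ U = p - 1 ∨ finrank ℚ U = p := by
  have hp3 : 3 ≤ p := by have := hp.two_le; omega
  have : FiniteDimensional ℚ E := FiniteDimensional.of_finrank_pos (by omega)
  obtain ⟨b, hb, hb0⟩ := finrank_eq_finrank_ker_add_mul hp T hT
  obtain ⟨n, rfl⟩ : ∃ n, p = n + 3 := ⟨p - 3, by omega⟩
  have hle : finrank ℚ U ≤ n + 3 := hE ▸ U.finrank_le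
  have hTU : (T.restrict hU) ^ (n + 3) = 1 := by
    ext x
    simp [Module.End.pow_restrict, hT]
  obtain ⟨b', hb', -⟩ := finrank_eq_finrank_ker_add_mul hp _ hTU
  have hker : finrank ℚ (LinearMap.ker (T.restrict hU - 1)) ≤ finrank ℚ (LinearMap.ker (T - 1)) := by
    have hmem : ∀ x : LinearMap.ker (T.restrict hU - 1),
        U.subtype.domRestrict _ x ∈ LinearMap.ker (T - 1) := by
      rintro ⟨x, hx⟩
      exact congrArg U.subtype hx
    exact LinearMap.finrank_le_finrank_of_injective
      (f := (U.subtype.domRestrict _).codRestrict _ hmem)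
      (fun x y h => Subtype.ext (Subtype.ext (congrArg (fun z : LinearMap.ker (T - 1) => (z : E)) h)))
  have hker1 : finrank ℚ (LinearMap.ker (T - 1)) ≤ 1 := by
    have := hb0 hT1
    rcases b with _ | _ | b
    · simp at this
    · simp at hb; omega
    · simp at hb; nlinarith
  rcases b' with _ | _ | b'
  · simp at hb'; omega
  · simp at hb' ⊢; omega
  · simp at hb'; nlinarith

end LinearAlgebra

namespace PaperAux

open Module

variable {g : ℕ}

/-- The index in `Fin g` underlying a symbol of `X g`. -/
def index (x : X g) : Fin g := Sum.elim id id x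

/-- The class of the level set partition containing the index of a symbol. -/
def levelOf (G : Subgroup (Equiv.Perm (X g))) (x : X g) : Quotient (levelSetoid G) :=
  Quotient.mk (levelSetoid G) (index x)

/-- `γ` fixes or conjugates every symbol. -/
def IsSignChange (γ : Equiv.Perm (X g)) : Prop := ∀ x, γ x = x ∨ γ x = x.swap

theorem swap_ne (x : X g) : x.swap ≠ x := by cases x <;> simp

theorem apply_swap {G : Subgroup (Equiv.Perm (X g))} (hGW : G ≤ Wgrp g) {σ : Equiv.Perm (X g)}
    (hσ : σ ∈ G) (x : X g) : σ x.swap = (σ x).swap :=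
  (Equiv.congr_fun (Subgroup.mem_centralizer_iff.mp (hGW hσ) _ rfl) x).symm

theorem isSignChange_iff {G : Subgroup (Equiv.Perm (X g))} (hGW : G ≤ Wgrp g)
    {γ : Equiv.Perm (X g)} (hγ : γ ∈ G) : IsSignChange γ ↔ ∀ k, plusFun γ k = k := by
  constructor
  · intro h k
    rcases h (Sum.inl k) with h | h <;> simp [plusFun, h]
  · intro h
    have hl : ∀ i, γ (Sum.inl i) = Sum.inl i ∨ γ (Sum.inl i) = Sum.inr i := by
      intro i
      have hi := h i
      unfold plusFun at hi
      rcases hx : γ (Sum.inl i) with j | j <;> rw [hx] at hi <;> simp_all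
    rintro (i | i)
    · exact hl i
    · have hs := apply_swap hGW hγ (Sum.inl i)
      rw [Sum.swap_inl] at hs
      rcases hl i with h | h <;> simp [hs, h]

theorem fixes_iff {G : Subgroup (Equiv.Perm (X g))} (hGW : G ≤ Wgrp g)
    {γ : Equiv.Perm (X g)} (hγ : γ ∈ G) (h : IsSignChange γ) (x : X g) :
    γ x = x ↔ ¬ γ (Sum.inl (index x)) = Sum.inr (index x) := by
  rcases x with i | i
  · rcases h (Sum.inl i) with h | h <;> simp [h, index]
  · have hs := apply_swap hGW hγ (Sum.inl i)
    rw [Sum.swap_inl] at hs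
    rcases h (Sum.inl i) with h | h <;> simp [hs, h, index]

theorem levelOf_eq_iff {G : Subgroup (Equiv.Perm (X g))} (hGW : G ≤ Wgrp g) (x y : X g) :
    levelOf G x = levelOf G y ↔ ∀ γ ∈ G, IsSignChange γ → (γ x = x ↔ γ y = y) := by
  rw [levelOf, levelOf, Quotient.eq]
  change levelRel G _ _ ↔ _
  constructor
  · intro h γ hγ hs
    rw [fixes_iff hGW hγ hs, fixes_iff hGW hγ hs, h γ hγ ((isSignChange_iff hGW hγ).mp hs)]
  · intro h γ hγ hs
    have hs' := (isSignChange_iff hGW hγ).mpr hs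
    have := h γ hγ hs'
    rw [fixes_iff hGW hγ hs', fixes_iff hGW hγ hs'] at this
    exact not_iff_not.mp this

theorem levelOf_swap (G : Subgroup (Equiv.Perm (X g))) (x : X g) :
    levelOf G x.swap = levelOf G x := by cases x <;> rfl

theorem levelOf_apply_eq {G : Subgroup (Equiv.Perm (X g))} (hGW : G ≤ Wgrp g)
    {σ : Equiv.Perm (X g)} (hσ : σ ∈ G) {x y : X g} (h : levelOf G x = levelOf G y) :
    levelOf G (σ x) = levelOf G (σ y) := by
  rw [levelOf_eq_iff hGW] at h ⊢
  intro γ hγ hs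
  have := h (σ⁻¹ * γ * σ) (G.mul_mem (G.mul_mem (G.inv_mem hσ) hγ) hσ) fun z => by
    rcases hs (σ z) with h | h
    · left; simp [h]
    · right; simp [h, ← apply_swap hGW hσ]
  rwa [Equiv.Perm.mul_apply, Equiv.Perm.mul_apply, Equiv.Perm.mul_apply, Equiv.Perm.mul_apply,
    Equiv.Perm.inv_eq_iff_eq, Equiv.Perm.inv_eq_iff_eq] at this

theorem levelOf_apply_eq_iff {G : Subgroup (Equiv.Perm (X g))} (hGW : G ≤ Wgrp g)
    {σ : Equiv.Perm (X g)} (hσ : σ ∈ G) {x y : X g} :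
    levelOf G (σ x) = levelOf G (σ y) ↔ levelOf G x = levelOf G y :=
  ⟨fun h => by simpa using levelOf_apply_eq hGW (G.inv_mem hσ) h, levelOf_apply_eq hGW hσ⟩

theorem levelOf_surjective (G : Subgroup (Equiv.Perm (X g))) :
    Function.Surjective (levelOf G) := by
  rintro ⟨i⟩
  exact ⟨Sum.inl i, rfl⟩

/-- `U` is a `G`-stable space of functions that are odd under conjugation. -/
structure IsOddStable (G : Subgroup (Equiv.Perm (X g))) (U : Submodule ℚ (X g → ℚ)) : Prop where
  odd : ∀ f ∈ U, ∀ x, f x.swap = -f x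
  comp_mem : ∀ f ∈ U, ∀ σ ∈ G, f ∘ σ ∈ U

/-- The functions in `U` supported on the level set `k`. -/
def levelPart (G : Subgroup (Equiv.Perm (X g))) (U : Submodule ℚ (X g → ℚ))
    (k : Quotient (levelSetoid G)) : Submodule ℚ (X g → ℚ) :=
  U ⊓ { carrier := {f | ∀ x, levelOf G x ≠ k → f x = 0}
        add_mem' := fun ha hb x hx => by simp [ha x hx, hb x hx]
        zero_mem' := fun _ _ => rfl
        smul_mem' := fun c f hf x hx => by simp [hf x hx] }

open Classical in
/-- The indicator function of the level set `k`. -/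
noncomputable def levelIndicator (G : Subgroup (Equiv.Perm (X g)))
    (k : Quotient (levelSetoid G)) (x : X g) : ℚ := if levelOf G x = k then 1 else 0

/-- The functions which multiply `U` into itself. -/
def multipliers (U : Submodule ℚ (X g → ℚ)) : Subalgebra ℚ (X g → ℚ) where
  carrier := {a | ∀ f ∈ U, a * f ∈ U}
  mul_mem' := fun ha hb f hf => by rw [mul_assoc]; exact ha _ (hb _ hf)
  add_mem' := fun ha hb f hf => by rw [add_mul]; exact U.add_mem (ha _ hf) (hb _ hf)
  algebraMap_mem' := fun r f hf => by rw [← Algebra.smul_def]; exact U.smul_mem r hf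

theorem levelIndicator_mem_multipliers {G : Subgroup (Equiv.Perm (X g))} (hGW : G ≤ Wgrp g)
    {U : Submodule ℚ (X g → ℚ)} (hU : IsOddStable G U) (k : Quotient (levelSetoid G)) :
    levelIndicator G k ∈ multipliers U := by
  classical
  have hsep : ∀ l, ∃ a ∈ multipliers U, (∀ x, levelOf G x = k → a x = 1) ∧
      (l ≠ k → ∀ x, levelOf G x = l → a x = 0) := by
    intro l
    by_cases hl : l = k
    · exact ⟨1, one_mem _, fun _ _ => rfl, fun h => absurd hl h⟩
    obtain ⟨x, rfl⟩ := levelOf_surjective G k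
    obtain ⟨y, rfl⟩ := levelOf_surjective G l
    rw [levelOf_eq_iff hGW] at hl
    push Not at hl
    obtain ⟨γ, hγ, hs, hxy⟩ := hl
    let ε : X g → ℚ := fun z => if γ z = z then 1 else -1
    have hε : ε ∈ multipliers U := fun f hf => by
      convert hU.comp_mem f hf γ hγ using 1
      ext z
      rcases hs z with h | h
      · simp [ε, h]
      · simp [ε, h, swap_ne, hU.odd f hf]
    have hconst : ∀ z z', levelOf G z = levelOf G z' → ε z = ε z' := fun z z' h => by
      have := (levelOf_eq_iff hGW z z').mp h γ hγ hs
      simp [ε, this]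
    refine ⟨algebraMap ℚ _ (1 / 2) * (1 + algebraMap ℚ _ (ε x) * ε), mul_mem (algebraMap_mem _ _)
      (add_mem (one_mem _) (mul_mem (algebraMap_mem _ _) hε)), fun z hz => ?_, fun _ z hz => ?_⟩
    · simp only [Pi.mul_apply, Pi.add_apply, Pi.one_apply, Pi.algebraMap_apply, hconst z x hz]
      by_cases h : γ x = x <;> simp [ε, h] <;> norm_num
    · simp only [Pi.mul_apply, Pi.add_apply, Pi.one_apply, Pi.algebraMap_apply, hconst z y hz]
      by_cases h : γ x = x <;> by_cases h' : γ y = y <;> simp_all [ε]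
  choose a ha ha1 ha0 using hsep
  have : levelIndicator G k = ∏ l, a l := by
    ext x
    rw [Finset.prod_apply]
    by_cases hx : levelOf G x = k
    · simp [levelIndicator, hx, ha1 _ x hx]
    · rw [Finset.prod_eq_zero (Finset.mem_univ (levelOf G x)) (ha0 _ hx x rfl)]
      simp [levelIndicator, hx]
  rw [this]
  exact prod_mem fun l _ => ha l

theorem levelIndicator_mul_mem {G : Subgroup (Equiv.Perm (X g))} (hGW : G ≤ Wgrp g)
    {U : Submodule ℚ (X g → ℚ)} (hU : IsOddStable G U) (k : Quotient (levelSetoid G))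
    {f : X g → ℚ} (hf : f ∈ U) : levelIndicator G k * f ∈ levelPart G U k :=
  ⟨levelIndicator_mem_multipliers hGW hU k f hf, fun x hx => by simp [levelIndicator, hx]⟩

theorem finrank_eq_sum_levelPart {G : Subgroup (Equiv.Perm (X g))} (hGW : G ≤ Wgrp g)
    {U : Submodule ℚ (X g → ℚ)} (hU : IsOddStable G U) [Fintype (Quotient (levelSetoid G))] :
    finrank ℚ U = ∑ k, finrank ℚ (levelPart G U k) := by
  classical
  let φ : U →ₗ[ℚ] ∀ k, levelPart G U k :=
    { toFun := fun f k => ⟨levelIndicator G k * f, levelIndicator_mul_mem hGW hU k f.2⟩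
      map_add' := fun f f' => by ext; simp [mul_add]
      map_smul' := fun c f => by ext; simp [mul_left_comm] }
  rw [← Module.finrank_pi_fintype]
  refine (LinearEquiv.ofBijective φ ⟨fun f f' h => ?_, fun F => ?_⟩).finrank_eq
  · ext x
    have := congrFun (congrArg Subtype.val (congrFun h (levelOf G x))) x
    simpa [φ, levelIndicator] using this
  · refine ⟨⟨∑ k, (F k : X g → ℚ), sum_mem fun k _ => (F k).2.1⟩, ?_⟩
    ext k x
    simp only [φ, LinearMap.coe_mk, AddHom.coe_mk, Pi.mul_apply, Finset.sum_apply]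
    by_cases hx : levelOf G x = k
    · rw [Finset.sum_eq_single k (fun l _ hl => (F l).2.2 x (by rw [hx]; exact hl.symm)) (by simp)]
      simp [levelIndicator, hx]
    · simp [levelIndicator, hx, (F k).2.2 x hx]

theorem finrank_levelPart_le {G : Subgroup (Equiv.Perm (X g))} (hGW : G ≤ Wgrp g)
    (htrans : ∀ x y : X g, ∃ σ ∈ G, σ x = y) {U : Submodule ℚ (X g → ℚ)} (hU : IsOddStable G U)
    (k l : Quotient (levelSetoid G)) :
    finrank ℚ (levelPart G U k) ≤ finrank ℚ (levelPart G U l) := by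
  obtain ⟨x, rfl⟩ := levelOf_surjective G k
  obtain ⟨y, rfl⟩ := levelOf_surjective G l
  obtain ⟨σ, hσ, rfl⟩ := htrans y x
  refine LinearMap.finrank_le_finrank_of_injective
    (f := ((LinearMap.funLeft ℚ ℚ σ).restrict fun f hf => ?_)) fun f f' h => ?_
  · exact ⟨hU.comp_mem f hf.1 σ hσ, fun z hz =>
      hf.2 _ (mt (levelOf_apply_eq_iff hGW hσ).mp hz)⟩
  · exact Subtype.ext (LinearMap.funLeft_injective_of_surjective ℚ ℚ σ σ.surjective
      (congrArg Subtype.val h))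

theorem finrank_eq_numLevels_mul {G : Subgroup (Equiv.Perm (X g))} (hGW : G ≤ Wgrp g)
    (htrans : ∀ x y : X g, ∃ σ ∈ G, σ x = y) {U : Submodule ℚ (X g → ℚ)} (hU : IsOddStable G U)
    (k : Quotient (levelSetoid G)) :
    finrank ℚ U = numLevels G * finrank ℚ (levelPart G U k) := by
  classical
  have := Fintype.ofFinite (Quotient (levelSetoid G))
  rw [finrank_eq_sum_levelPart hGW hU, numLevels, Nat.card_eq_fintype_card,
    Finset.sum_congr rfl fun l _ => (finrank_levelPart_le hGW htrans hU l k).antisymm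
      (finrank_levelPart_le hGW htrans hU k l)]
  simp

/-- The space of functions that are odd under conjugation. -/
def oddFunctions (g : ℕ) : Submodule ℚ (X g → ℚ) where
  carrier := {f | ∀ x, f x.swap = -f x}
  add_mem' := fun ha hb x => by simp [ha x, hb x, add_comm]
  zero_mem' := fun _ => by simp
  smul_mem' := fun c f hf x => by simp [hf x]

theorem isOddStable_oddFunctions {G : Subgroup (Equiv.Perm (X g))} (hGW : G ≤ Wgrp g) :
    IsOddStable G (oddFunctions g) where
  odd := fun _ hf => hf
  comp_mem := fun f hf σ hσ x => by simp [apply_swap hGW hσ, hf (σ x)]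

theorem finrank_oddFunctions (g : ℕ) : finrank ℚ (oddFunctions g) = g := by
  let φ : oddFunctions g →ₗ[ℚ] (Fin g → ℚ) :=
    (LinearMap.funLeft ℚ ℚ Sum.inl).domRestrict _
  rw [(LinearEquiv.ofBijective φ ⟨fun f f' h => ?_, fun F => ?_⟩).finrank_eq]
  · simp
  · have hl : ∀ i, f.1 (Sum.inl i) = f'.1 (Sum.inl i) := congrFun h
    ext (i | i)
    · exact hl i
    · have h1 := f.2 (Sum.inl i)
      have h2 := f'.2 (Sum.inl i)
      rw [Sum.swap_inl] at h1 h2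
      rw [h1, h2, hl]
  · exact ⟨⟨Sum.elim F (-F), by rintro (i | i) <;> simp⟩, rfl⟩

theorem card_eq_numLevels_mul {G : Subgroup (Equiv.Perm (X g))} (hGW : G ≤ Wgrp g)
    (htrans : ∀ x y : X g, ∃ σ ∈ G, σ x = y) (k : Quotient (levelSetoid G)) :
    2 * g = numLevels G * Nat.card {x : X g // levelOf G x = k} := by
  classical
  have := Fintype.ofFinite (Quotient (levelSetoid G))
  have hle : ∀ k l, Nat.card {x : X g // levelOf G x = k} ≤
      Nat.card {x : X g // levelOf G x = l} := by
    intro k l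
    obtain ⟨x, rfl⟩ := levelOf_surjective G k
    obtain ⟨y, rfl⟩ := levelOf_surjective G l
    obtain ⟨σ, hσ, rfl⟩ := htrans x y
    exact Nat.card_le_card_of_injective
      (fun z => ⟨σ z.1, levelOf_apply_eq hGW hσ z.2⟩)
      fun z z' h => Subtype.ext (σ.injective (congrArg Subtype.val h))
  have := Nat.card_congr (Equiv.sigmaFiberEquiv (levelOf G))
  rw [Nat.card_sigma, Finset.sum_congr rfl fun l _ => (hle l k).antisymm (hle k l)] at this
  rw [numLevels, Nat.card_eq_fintype_card]
  simp at this
  simp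
  omega

/-- The permutations of the level set `k` induced by elements of `G`. -/
def levelAction (G : Subgroup (Equiv.Perm (X g))) (k : Quotient (levelSetoid G)) :
    Subgroup (Equiv.Perm {x : X g // levelOf G x = k}) where
  carrier := {τ | ∃ σ ∈ G, ∀ x, (τ x : X g) = σ x}
  mul_mem' := by
    rintro τ τ' ⟨σ, hσ, h⟩ ⟨σ', hσ', h'⟩
    exact ⟨σ * σ', G.mul_mem hσ hσ', fun x => by simp [h, h']⟩
  one_mem' := ⟨1, G.one_mem, fun x => rfl⟩
  inv_mem' := by
    rintro τ ⟨σ, hσ, h⟩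
    exact ⟨σ⁻¹, G.inv_mem hσ, fun x => by rw [Equiv.Perm.eq_inv_iff_eq, ← h]; simp⟩

theorem card_dvd_card_levelAction {G : Subgroup (Equiv.Perm (X g))} (hGW : G ≤ Wgrp g)
    (htrans : ∀ x y : X g, ∃ σ ∈ G, σ x = y) (k : Quotient (levelSetoid G)) :
    Nat.card {x : X g // levelOf G x = k} ∣ Nat.card (levelAction G k) := by
  have : MulAction.IsPretransitive (levelAction G k) {x : X g // levelOf G x = k} := by
    refine ⟨fun ⟨x, hx⟩ ⟨y, hy⟩ => ?_⟩
    obtain ⟨σ, hσ, rfl⟩ := htrans x y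
    have hk : ∀ z, levelOf G z = k ↔ levelOf G (σ z) = k := fun z => by
      rw [← hx, ← levelOf_apply_eq_iff hGW hσ, hx, hy]
    exact ⟨⟨σ.subtypeEquiv hk, σ, hσ, fun _ => rfl⟩, rfl⟩
  obtain ⟨x, hx⟩ := levelOf_surjective G k
  rw [← MulAction.index_stabilizer_of_transitive (levelAction G k)
    (⟨x, hx⟩ : {x : X g // levelOf G x = k})]
  exact Subgroup.index_dvd_card _

theorem exists_pow_prime_fixing_level {G : Subgroup (Equiv.Perm (X g))} (hGW : G ≤ Wgrp g)
    (htrans : ∀ x y : X g, ∃ σ ∈ G, σ x = y) {p : ℕ} (hp : p.Prime)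
    (k : Quotient (levelSetoid G)) (hpk : p ∣ Nat.card {x : X g // levelOf G x = k}) :
    ∃ σ ∈ G, (∀ x, levelOf G (σ x) = k ↔ levelOf G x = k) ∧
      (∀ x, levelOf G x = k → (σ ^ p) x = x) ∧ ∃ x, levelOf G x = k ∧ σ x ≠ x := by
  have : Fact p.Prime := ⟨hp⟩
  obtain ⟨⟨τ, hmem⟩, hτ⟩ := exists_prime_orderOf_dvd_card' p
    (hpk.trans (card_dvd_card_levelAction hGW htrans k))
  rw [Subgroup.orderOf_mk] at hτ
  obtain ⟨σ, hσ, h⟩ := hmem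
  obtain ⟨x₀, hx₀⟩ := levelOf_surjective G k
  have hσx₀ : levelOf G (σ x₀) = k := by rw [← h ⟨x₀, hx₀⟩]; exact (τ _).2
  have hpow : ∀ n x, ((τ ^ n) x : X g) = (σ ^ n) x := by
    intro n
    induction n with
    | zero => exact fun _ => rfl
    | succ n ih => intro x; rw [pow_succ', pow_succ', Equiv.Perm.mul_apply, h, ih]; rfl
  refine ⟨σ, hσ, fun x => ?_, fun x hx => ?_, ?_⟩
  · simpa only [hσx₀, hx₀] using levelOf_apply_eq_iff hGW hσ (x := x) (y := x₀)
  · rw [← hpow p ⟨x, hx⟩, ← hτ, pow_orderOf_eq_one]; rfl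
  · by_contra! hfix
    have : τ = 1 := by
      ext x
      rw [h, hfix x x.2]; rfl
    rw [this, orderOf_one] at hτ
    exact hp.one_lt.ne hτ

theorem finrank_levelPart_mem {G : Subgroup (Equiv.Perm (X g))} (hGW : G ≤ Wgrp g)
    (htrans : ∀ x y : X g, ∃ σ ∈ G, σ x = y) {p : ℕ} (hp : p.Prime)
    {k : Quotient (levelSetoid G)} (hpk : p ∣ Nat.card {x : X g // levelOf G x = k})
    (hodd : finrank ℚ (levelPart G (oddFunctions g) k) = p)
    {U : Submodule ℚ (X g → ℚ)} (hU : IsOddStable G U) :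
    finrank ℚ (levelPart G U k) = 0 ∨ finrank ℚ (levelPart G U k) = 1 ∨
      finrank ℚ (levelPart G U k) = p - 1 ∨ finrank ℚ (levelPart G U k) = p := by
  classical
  have hle : levelPart G U k ≤ levelPart G (oddFunctions g) k := fun f hf => ⟨hU.odd f hf.1, hf.2⟩
  by_cases h2 : p = 2
  · have := Submodule.finrank_mono hle
    omega
  obtain ⟨σ, hσ, hσk, hσp, x₀, hx₀, hσx₀⟩ := exists_pow_prime_fixing_level hGW htrans hp k hpk
  have hstable : ∀ {V : Submodule ℚ (X g → ℚ)}, IsOddStable G V → ∀ f ∈ levelPart G V k,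
      LinearMap.funLeft ℚ ℚ σ f ∈ levelPart G V k := fun hV f hf =>
    ⟨hV.comp_mem f hf.1 σ hσ, fun x hx => hf.2 _ (mt (hσk x).mp hx)⟩
  let T := (LinearMap.funLeft ℚ ℚ σ).restrict (hstable (isOddStable_oddFunctions hGW))
  have hTpow : ∀ n f x, ((T ^ n) f : X g → ℚ) x = f.1 ((σ ^ n) x) := by
    intro n
    induction n with
    | zero => exact fun _ _ => rfl
    | succ n ih => intro f x; rw [pow_succ, Module.End.mul_apply, ih, pow_succ']; rfl
  have hT : T ^ p = 1 := by
    ext f x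
    rw [hTpow]
    by_cases hx : levelOf G x = k
    · rw [hσp x hx]; rfl
    · rw [← hTpow, ((T ^ p) f).2.2 x hx]
      exact (f.2.2 x hx).symm
  have hT1 : T ≠ 1 := by
    intro h
    let f : X g → ℚ := fun x => if x = σ x₀ then 1 else if x = (σ x₀).swap then -1 else 0
    have hf : f ∈ levelPart G (oddFunctions g) k := by
      have hk := (hσk x₀).mpr hx₀
      refine ⟨fun x => ?_, fun x hx => ?_⟩
      · by_cases h1 : x = σ x₀
        · simp [f, h1, swap_ne]
        · by_cases h2 : x = (σ x₀).swap
          · simp [f, h2, swap_ne]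
          · have h3 : x.swap ≠ (σ x₀).swap := fun h => h1 (by simpa using congrArg Sum.swap h)
            have h4 : x.swap ≠ σ x₀ := fun h => h2 (by simpa using congrArg Sum.swap h)
            simp [f, h1, h2, h3, h4]
      · have h1 : x ≠ σ x₀ := by rintro rfl; exact hx hk
        have h2 : x ≠ (σ x₀).swap := by rintro rfl; exact hx (by rw [levelOf_swap, hk])
        simp [f, h1, h2]
    have hfx : f (σ x₀) = f x₀ := congrFun (congrArg Subtype.val (LinearMap.congr_fun h ⟨f, hf⟩)) x₀
    simp only [f, if_true, if_neg hσx₀.symm] at hfx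
    split_ifs at hfx <;> norm_num at hfx
  rw [← (Submodule.comapSubtypeEquivOfLe hle).finrank_eq]
  exact finrank_mem_of_pow_prime_eq_one hp h2 hodd T hT hT1 _
    fun f hf => hstable hU f.1 hf

/-- The span of the `G`-translates of `f`. -/
def translateSpan (G : Subgroup (Equiv.Perm (X g))) (f : X g → ℚ) : Submodule ℚ (X g → ℚ) :=
  Submodule.span ℚ (Set.range fun σ : G => f ∘ (σ : Equiv.Perm (X g)))

theorem isOddStable_translateSpan {G : Subgroup (Equiv.Perm (X g))} (hGW : G ≤ Wgrp g)
    {f : X g → ℚ} (hf : f ∈ oddFunctions g) : IsOddStable G (translateSpan G f) where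
  odd := by
    have : translateSpan G f ≤ oddFunctions g := by
      rw [translateSpan, Submodule.span_le]
      rintro _ ⟨σ, rfl⟩
      exact (isOddStable_oddFunctions hGW).comp_mem f hf σ σ.2
    exact fun f' hf' => this hf'
  comp_mem := by
    intro f' hf' σ hσ
    have : translateSpan G f ≤ (translateSpan G f).comap (LinearMap.funLeft ℚ ℚ σ) := by
      conv_lhs => rw [translateSpan]
      rw [Submodule.span_le]
      rintro _ ⟨τ, rfl⟩
      exact Submodule.subset_span ⟨τ * ⟨σ, hσ⟩, rfl⟩
    exact this hf'

theorem mem_translateSpan (G : Subgroup (Equiv.Perm (X g))) (f : X g → ℚ) :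
    f ∈ translateSpan G f := Submodule.subset_span ⟨1, rfl⟩

theorem coeff_Phi (w : X g → ℚ) (G : Subgroup (Equiv.Perm (X g))) (x : X g) (σ : G) :
    (Phi w G x).coeff σ = w ((σ : Equiv.Perm (X g))⁻¹ x) := by
  classical
  have := Fintype.ofFinite G
  rw [Phi, finsum_eq_sum_of_fintype]
  change MonoidAlgebra.coeffLinearEquiv ℚ _ σ = _
  rw [map_sum, Finsupp.finsetSum_apply, Finset.sum_eq_single σ]
  · simp
  · intro τ _ hτ
    simp [hτ]
  · simp

theorem finrank_span_Phi (w : X g → ℚ) (G : Subgroup (Equiv.Perm (X g))) :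
    finrank ℚ (Submodule.span ℚ (Set.range (Phi w G))) = finrank ℚ (translateSpan G w) := by
  classical
  have := Fintype.ofFinite G
  let e : MonoidAlgebra ℚ G ≃ₗ[ℚ] (G → ℚ) :=
    (MonoidAlgebra.coeffLinearEquiv ℚ).trans (Finsupp.linearEquivFunOnFinite ℚ ℚ G)
  let A : Matrix (X g) G ℚ := Matrix.of fun x σ => w ((σ : Equiv.Perm (X g))⁻¹ x)
  have hrow : (Submodule.span ℚ (Set.range (Phi w G))).map (e : MonoidAlgebra ℚ G →ₗ[ℚ] (G → ℚ)) =
      Submodule.span ℚ (Set.range A.row) := by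
    rw [Submodule.map_span, ← Set.range_comp]
    congr 2
    ext x σ
    exact coeff_Phi w G x σ
  have hcol : translateSpan G w = Submodule.span ℚ (Set.range A.col) := by
    rw [translateSpan, ← (Equiv.inv G).surjective.range_comp]
    rfl
  rw [← LinearEquiv.finrank_map_eq e, hcol, ← Matrix.rank_eq_finrank_span_cols,
    ← Matrix.rank_transpose, Matrix.rank_eq_finrank_span_cols]
  exact congrArg (fun V : Submodule ℚ (G → ℚ) => finrank ℚ V) hrow

theorem angleRank_eq_finrank {w : X g → ℚ} (hw : IsWeightFn g w) (hg : 0 < g)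
    {G : Subgroup (Equiv.Perm (X g))} (hGW : G ≤ Wgrp g) (hc : conjPerm g ∈ G)
    (hodd : (fun x => w x - 1 / 2) ∈ oddFunctions g) :
    angleRank w G = finrank ℚ (translateSpan G fun x => w x - 1 / 2) := by
  set u : X g → ℚ := fun x => w x - 1 / 2
  have hone : (1 : X g → ℚ) ∈ translateSpan G w := by
    have : (1 : X g → ℚ) = w + w ∘ conjPerm g := by
      ext (i | i)
      · exact (hw.add_one i).symm
      · exact ((add_comm _ _).trans (hw.add_one i)).symm
    rw [this]
    exact add_mem (mem_translateSpan G w) (Submodule.subset_span ⟨⟨_, hc⟩, rfl⟩)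
  have hsup : translateSpan G w = translateSpan G u ⊔ Submodule.span ℚ {1} := by
    apply le_antisymm
    · conv_lhs => rw [translateSpan]
      rw [Submodule.span_le]
      rintro _ ⟨σ, rfl⟩
      have : w ∘ (σ : Equiv.Perm (X g)) = u ∘ (σ : Equiv.Perm (X g)) + (1 / 2 : ℚ) • 1 := by
        ext x; simp [u]
      beta_reduce
      rw [this]
      exact Submodule.add_mem_sup (Submodule.subset_span ⟨σ, rfl⟩)
        (Submodule.smul_mem _ _ (Submodule.mem_span_singleton_self _))
    · refine sup_le ?_ (by simpa using hone)
      rw [translateSpan, Submodule.span_le]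
      rintro _ ⟨σ, rfl⟩
      have : u ∘ (σ : Equiv.Perm (X g)) = w ∘ (σ : Equiv.Perm (X g)) - (1 / 2 : ℚ) • 1 := by
        ext x; simp [u]
      beta_reduce
      rw [this]
      exact sub_mem (Submodule.subset_span ⟨σ, rfl⟩) (Submodule.smul_mem _ _ hone)
  have hinf : translateSpan G u ⊓ Submodule.span ℚ {1} = ⊥ := by
    rw [eq_bot_iff]
    rintro f ⟨hf, hf1⟩
    obtain ⟨a, rfl⟩ := Submodule.mem_span_singleton.mp hf1
    have := (isOddStable_translateSpan hGW hodd).odd _ hf (Sum.inl ⟨0, hg⟩)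
    simp only [Pi.smul_apply, Pi.one_apply, smul_eq_mul, mul_one] at this
    have ha : a = 0 := by linarith
    simp [ha]
  have hne : (1 : X g → ℚ) ≠ 0 := fun h => one_ne_zero (congrFun h (Sum.inl ⟨0, hg⟩))
  have hdim := Submodule.finrank_sup_add_finrank_inf_eq (translateSpan G u) (Submodule.span ℚ {1})
  rw [← hsup, hinf, finrank_bot, finrank_span_singleton hne, add_zero] at hdim
  rw [angleRank, finrank_span_Phi, hdim, Nat.add_sub_cancel]

end PaperAux

open PaperAux

/-- if `ρ` is not supersingular, `m ∣ g` and `g/m` is prime, then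
`δ_ρ ∈ {m, g − m, g}`. -/
theorem angleRank_mem_of_prime_quotient {g : ℕ} (w : X g → ℚ) (hw : IsWeightFn g w)
    (G : Subgroup (Equiv.Perm (X g))) (hGW : G ≤ Wgrp g) (hc : conjPerm g ∈ G)
    (htrans : ∀ x y : X g, ∃ σ ∈ G, σ x = y)
    (hss : ¬ (∀ x : X g, w x = 1/2))
    (hdvd : numLevels G ∣ g) (hprime : Nat.Prime (g / numLevels G)) :
    angleRank w G = numLevels G ∨ angleRank w G = g - numLevels G ∨ angleRank w G = g := by
  obtain ⟨p, hp⟩ := hdvd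
  push Not at hss
  obtain ⟨x₀, hx₀⟩ := hss
  have hg : 0 < g := (index x₀).pos
  have hm : 0 < numLevels G := Nat.pos_of_mul_pos_right (hp ▸ hg)
  have hpp : p.Prime := by
    rwa [Nat.div_eq_of_eq_mul_right hm hp] at hprime
  have hodd : (fun x => w x - 1 / 2) ∈ oddFunctions g := by
    rintro (i | i) <;> have := hw.add_one i <;> simp only [Sum.swap_inl, Sum.swap_inr] <;> linarith
  have hU := isOddStable_translateSpan hGW hodd
  have hoddrank := finrank_eq_numLevels_mul hGW htrans (isOddStable_oddFunctions hGW)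
    (levelOf G x₀)
  rw [finrank_oddFunctions] at hoddrank
  have hlevel := Nat.eq_of_mul_eq_mul_left hm (hoddrank.symm.trans hp)
  have hcard : Nat.card {x : X g // levelOf G x = levelOf G x₀} = p * 2 :=
    Nat.eq_of_mul_eq_mul_left hm (by rw [← card_eq_numLevels_mul hGW htrans, ← mul_assoc, ← hp,
      mul_comm])
  have hrank := finrank_eq_numLevels_mul hGW htrans hU (levelOf G x₀)
  rw [angleRank_eq_finrank hw hg hGW hc hodd]
  rcases finrank_levelPart_mem hGW htrans hpp (hcard ▸ dvd_mul_right _ _) hlevel hU with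
    h | h | h | h <;> rw [h] at hrank
  · rw [mul_zero, Submodule.finrank_eq_zero] at hrank
    have hu := hrank ▸ mem_translateSpan G fun x => w x - 1 / 2
    exact absurd (sub_eq_zero.mp (congrFun ((Submodule.mem_bot ℚ).mp hu) x₀)) hx₀
  · exact Or.inl (by rw [hrank, mul_one])
  · exact Or.inr (Or.inl (by rw [hrank, Nat.mul_sub_one, ← hp]))
  · exact Or.inr (Or.inr (by rw [hrank, ← hp]))
end

section
/- Under Setup (★) with a chosen indexing I, assume the associated wpr ρ = (w, G) is geometrically simple. Then ρ is exceptional if and only if there exist disjoint subsets T⁺, T⁻ ⊆ Fin g with T⁺ ∪ T⁻ nonempty and |T⁺| + |T⁻| even, and a root of unity ζ ∈ L, such that ∏_{i ∈ T⁺} I(Sum.inl i) = ζ · q^{(|T⁺| − |T⁻|)/2} · ∏_{j ∈ T⁻} I(Sum.inl j) in L (note (|T⁺| − |T⁻|)/2 is an integer, possibly negative). -/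
open scoped BigOperators

open NumberField

open PaperAux Polynomial

theorem multIdx_mul {R : Type*} [CommRing R] [IsDedekindDomain R] (P : Ideal R) {I J : Ideal R}
    (hI : I ≠ 0) (hJ : J ≠ 0) : multIdx P (I * J) = multIdx P I + multIdx P J := by
  rw [multIdx, UniqueFactorizationMonoid.normalizedFactors_mul hI hJ, Multiset.count_add]; rfl

theorem multIdx_one {R : Type*} [CommRing R] [IsDedekindDomain R] (P : Ideal R) :
    multIdx P (1 : Ideal R) = 0 := by
  rw [multIdx, UniqueFactorizationMonoid.normalizedFactors_one, Multiset.count_zero]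

theorem multIdx_pow {R : Type*} [CommRing R] [IsDedekindDomain R] (P : Ideal R) (I : Ideal R)
    (n : ℕ) : multIdx P (I ^ n) = n * multIdx P I := by
  simp [multIdx, UniqueFactorizationMonoid.normalizedFactors_pow]

theorem multIdx_prod {R : Type*} [CommRing R] [IsDedekindDomain R] (P : Ideal R) {ι : Type*}
    (s : Finset ι) {J : ι → Ideal R} (hJ : ∀ i, J i ≠ 0) :
    multIdx P (∏ i ∈ s, J i) = ∑ i ∈ s, multIdx P (J i) := by
  classical
  induction s using Finset.induction_on with
  | empty => simpa using multIdx_one P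
  | insert i s hi ih =>
    rw [Finset.prod_insert hi, Finset.sum_insert hi,
      multIdx_mul P (hJ i) (Finset.prod_ne_zero_iff.2 fun j _ => hJ j), ih]

theorem multIdx_eq_zero {R : Type*} [CommRing R] [IsDedekindDomain R] {P I : Ideal R}
    (h : ¬ I ≤ P) : multIdx P I = 0 := by
  rw [multIdx, Multiset.count_eq_zero]
  exact fun hP => h (Ideal.le_of_dvd (UniqueFactorizationMonoid.dvd_of_mem_normalizedFactors hP))

theorem multIdx_pos {R : Type*} [CommRing R] [IsDedekindDomain R] {P I : Ideal R}
    (hP : P.IsPrime) (hI : I ≠ 0) (h : I ≤ P) : 0 < multIdx P I := by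
  rw [multIdx, Multiset.count_pos]
  exact (Ideal.mem_normalizedFactors_iff hI).2 ⟨hP, h⟩

theorem multIdx_span_smul {R : Type*} [CommRing R] [IsDedekindDomain R] {G : Type*} [Group G]
    [MulSemiringAction G R] (σ : G) {P Q : Ideal R} (hP : Prime P) (hQ : Prime Q)
    (hPQ : ∀ x, σ • x ∈ Q ↔ x ∈ P) {x : R} (hx : x ≠ 0) :
    multIdx Q (Ideal.span {σ • x}) = multIdx P (Ideal.span {x}) := by
  classical
  have hσx : σ • x ≠ 0 := (smul_ne_zero_iff_ne σ).2 hx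
  have key : emultiplicity Q (Ideal.span {σ • x}) = emultiplicity P (Ideal.span {x}) := by
    refine emultiplicity_eq_emultiplicity_iff.2 fun n => ?_
    have hQ' : Q = P.map (MulSemiringAction.toRingEquiv G R σ) := by
      ext y
      rw [Ideal.mem_map_of_equiv]
      constructor
      · intro hy
        exact ⟨σ⁻¹ • y, (hPQ _).1 (by simpa using hy), by simp⟩
      · rintro ⟨z, hz, rfl⟩
        exact (hPQ z).2 hz
    rw [Ideal.dvd_span_singleton, Ideal.dvd_span_singleton, hQ', ← Ideal.map_pow,
      Ideal.mem_map_of_equiv]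
    constructor
    · rintro ⟨z, hz, h⟩
      have : z = x := by simpa using h
      exact this ▸ hz
    · exact fun h => ⟨x, h, rfl⟩
  rw [UniqueFactorizationMonoid.emultiplicity_eq_count_normalizedFactors hQ.irreducible
    (by simpa using hσx), UniqueFactorizationMonoid.emultiplicity_eq_count_normalizedFactors
    hP.irreducible (by simpa using hx), normalize_eq, normalize_eq] at key
  rw [multIdx, multIdx]
  convert! Nat.cast_injective key

theorem associated_of_multIdx_eq {R : Type*} [CommRing R] [IsDedekindDomain R] {a b : R}
    (ha : a ≠ 0) (hb : b ≠ 0)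
    (h : ∀ P : Ideal R, P ≠ ⊥ → P.IsPrime →
      multIdx P (Ideal.span {a}) = multIdx P (Ideal.span {b})) :
    Associated a b := by
  classical
  have ha' : Ideal.span {a} ≠ 0 := by simpa using ha
  have hb' : Ideal.span {b} ≠ 0 := by simpa using hb
  rw [← Ideal.span_singleton_eq_span_singleton, ← associated_iff_eq,
    UniqueFactorizationMonoid.associated_iff_normalizedFactors_eq_normalizedFactors ha' hb']
  ext P
  by_cases hP : Prime P
  · have := h P hP.ne_zero (Ideal.isPrime_of_prime hP)
    rw [multIdx, multIdx] at this
    convert! this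
  · rw [Multiset.count_eq_zero_of_notMem, Multiset.count_eq_zero_of_notMem] <;>
    exact fun hm => hP (UniqueFactorizationMonoid.prime_of_normalized_factor P hm)

theorem Phi_coeff {g : ℕ} (w : X g → ℚ) (G : Subgroup (Equiv.Perm (X g))) (x : X g) (σ : G) :
    (Phi w G x).coeff σ = w ((σ : Equiv.Perm (X g))⁻¹ x) := by
  classical
  rw [Phi, finsum_eq_sum_of_fintype]
  simp [MonoidAlgebra.coeff_sum, Finsupp.single_apply]

theorem allSum_coeff {g : ℕ} (G : Subgroup (Equiv.Perm (X g))) (σ : G) :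
    (allSum G).coeff σ = 1 := by
  classical
  rw [allSum, finsum_eq_sum_of_fintype]
  simp [MonoidAlgebra.coeff_sum, Finsupp.single_apply]

theorem excId_iff {g : ℕ} (w : X g → ℚ) (G : Subgroup (Equiv.Perm (X g)))
    (Tp Tm : Finset (Fin g)) :
    ExcId w G Tp Tm ↔ ∀ σ ∈ G, ∑ i ∈ Tp, w (σ (Sum.inl i)) - ∑ j ∈ Tm, w (σ (Sum.inl j)) =
      ((Tp.card : ℚ) - Tm.card) / 2 := by
  have h : ExcId w G Tp Tm ↔ ∀ σ : G, ∑ i ∈ Tp, w ((σ : Equiv.Perm (X g))⁻¹ (Sum.inl i)) -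
      ∑ j ∈ Tm, w ((σ : Equiv.Perm (X g))⁻¹ (Sum.inl j)) = ((Tp.card : ℚ) - Tm.card) / 2 := by
    rw [ExcId, MonoidAlgebra.ext_iff]
    simp [DFunLike.ext_iff, MonoidAlgebra.coeff_sum, Phi_coeff, allSum_coeff]
  rw [h]
  constructor
  · intro H σ hσ
    simpa using H ⟨σ⁻¹, G.inv_mem hσ⟩
  · intro H σ
    exact H _ (G.inv_mem σ.2)

theorem associated_iff_exists_root_of_unity {L : Type*} [Field L] [NumberField L] {a b : 𝓞 L}
    (hb : b ≠ 0) (h : ∀ φ : L →+* ℂ, ‖φ (a : L)‖ = ‖φ (b : L)‖) :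
    Associated a b ↔ ∃ ζ : L, (∃ m : ℕ, 1 ≤ m ∧ ζ ^ m = 1) ∧ (a : L) = ζ * (b : L) := by
  constructor
  · intro hab
    obtain ⟨u, hu⟩ := hab.symm
    have hu' : (a : L) = ((u : 𝓞 L) : L) * (b : L) := by
      rw [← hu, mul_comm]
      exact map_mul (algebraMap (𝓞 L) L) _ _
    refine ⟨((u : 𝓞 L) : L), ?_, hu'⟩
    obtain ⟨m, hm, h1⟩ := NumberField.Embeddings.pow_eq_one_of_norm_eq_one L ℂ
      (x := ((u : 𝓞 L) : L)) (u : 𝓞 L).isIntegral_coe fun φ => by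
        have h2 := h φ
        have hφb : ‖φ (b : L)‖ ≠ 0 := by simpa using hb
        rw [hu', map_mul, norm_mul] at h2
        exact (mul_eq_right₀ hφb).1 h2
    exact ⟨m, hm, h1⟩
  · rintro ⟨ζ, ⟨m, hm, h1⟩, hab⟩
    have hζ : IsIntegral ℤ ζ := IsIntegral.of_pow hm (h1 ▸ isIntegral_one)
    have hunit : IsUnit (⟨ζ, hζ⟩ : 𝓞 L) :=
      IsUnit.of_pow_eq_one (n := m) (RingOfIntegers.ext h1) (by omega)
    rw [show a = b * ⟨ζ, hζ⟩ from RingOfIntegers.ext (hab.trans (mul_comm _ _))]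
    exact associated_mul_unit_left b _ hunit

theorem under_int_eq_span {R : Type*} [CommRing R] {p : ℕ} (hp : p.Prime)
    {P : Ideal R} (hP : P.IsPrime) (h : (p : R) ∈ P) :
    P.under ℤ = Ideal.span {(p : ℤ)} := by
  have hmax : (Ideal.span {(p : ℤ)}).IsMaximal :=
    PrincipalIdealRing.isMaximal_of_irreducible (Nat.prime_iff_prime_int.1 hp).irreducible
  refine (hmax.eq_of_le (Ideal.IsPrime.under ℤ P).ne_top ?_).symm
  rw [Ideal.span_singleton_le_iff_mem, Ideal.mem_comap]
  simpa using h

open Pointwise in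
theorem forall_multIdx_smul_eq_iff_associated {L : Type*} [Field L] [NumberField L] [IsGalois ℚ L]
    {p : ℕ} (hp : p.Prime) {𝔄 : Ideal (𝓞 L)} (h𝔄 : 𝔄.IsMaximal) (h𝔄p : (p : 𝓞 L) ∈ 𝔄)
    {a b : 𝓞 L} (ha : a ≠ 0) (hb : b ≠ 0)
    (hap : ∀ P : Ideal (𝓞 L), P.IsPrime → a ∈ P → (p : 𝓞 L) ∈ P)
    (hbp : ∀ P : Ideal (𝓞 L), P.IsPrime → b ∈ P → (p : 𝓞 L) ∈ P) :
    (∀ σ : L ≃ₐ[ℚ] L, multIdx 𝔄 (Ideal.span {σ • a}) = multIdx 𝔄 (Ideal.span {σ • b})) ↔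
      Associated a b := by
  constructor
  · intro h
    refine associated_of_multIdx_eq ha hb fun P hP0 hP => ?_
    by_cases hpP : (p : 𝓞 L) ∈ P
    · obtain ⟨σ, hσ⟩ := Algebra.IsInvariant.exists_smul_of_under_eq ℤ (𝓞 L) (L ≃ₐ[ℚ] L) P 𝔄
        ((under_int_eq_span hp hP hpP).trans (under_int_eq_span hp h𝔄.isPrime h𝔄p).symm)
      have h𝔄0 : 𝔄 ≠ ⊥ := by
        rintro rfl
        exact hp.ne_zero (by simpa using h𝔄p)
      have hmem : ∀ x : 𝓞 L, σ • x ∈ 𝔄 ↔ x ∈ P := fun x => by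
        rw [hσ, Ideal.smul_mem_pointwise_smul_iff]
      have hP' := Ideal.prime_of_isPrime hP0 hP
      have h𝔄' := Ideal.prime_of_isPrime h𝔄0 h𝔄.isPrime
      rw [← multIdx_span_smul σ hP' h𝔄' hmem ha, ← multIdx_span_smul σ hP' h𝔄' hmem hb, h σ]
    · rw [multIdx_eq_zero, multIdx_eq_zero]
      · exact fun h => hpP (hbp P hP ((Ideal.span_singleton_le_iff_mem _).1 h))
      · exact fun h => hpP (hap P hP ((Ideal.span_singleton_le_iff_mem _).1 h))
  · intro h σ
    congr 1
    exact Ideal.span_singleton_eq_span_singleton.2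
      (h.map (MulSemiringAction.toRingHom (L ≃ₐ[ℚ] L) (𝓞 L) σ))

theorem multIdx_span_prod_mul_pow {R : Type*} [CommRing R] [IsDedekindDomain R] (P : Ideal R)
    {ι : Type*} (s : Finset ι) {f : ι → R} (hf : ∀ i, f i ≠ 0) {q : R} (hq : q ≠ 0) (n : ℕ) :
    multIdx P (Ideal.span {(∏ i ∈ s, f i) * q ^ n}) =
      ∑ i ∈ s, multIdx P (Ideal.span {f i}) + n * multIdx P (Ideal.span {q}) := by
  rw [← Ideal.span_singleton_mul_span_singleton, ← Ideal.prod_span_singleton,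
    ← Ideal.span_singleton_pow, multIdx_mul, multIdx_prod, multIdx_pow]
  · simpa using hf
  · exact Finset.prod_ne_zero_iff.2 fun i _ => by simpa using hf i
  · exact pow_ne_zero _ (by simpa using hq)

/-- under Setup (★) with an indexing `I` whose associated wpr `ρ = (w, G)` is
geometrically simple, `ρ` is exceptional iff there is a multiplicative relation
`∏_{i ∈ T⁺} I(i) = ζ · q^{(|T⁺|−|T⁻|)/2} · ∏_{j ∈ T⁻} I(j)` with `ζ` a root of unity. -/
theorem exceptional_iff_lambda_relation
    (g p k₀ : ℕ) (hg : 0 < g) (hp : p.Prime) (hk₀ : 1 ≤ k₀)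
    (K : Type*) [Field K] [NumberField K]
    (hdeg : Module.finrank ℚ K = 2 * g)
    (τ : K ≃ₐ[ℚ] K) (hτ : ∀ (ι : K →+* ℂ) (y : K), ι (τ y) = starRingEnd ℂ (ι y))
    (π : 𝓞 K)
    (hπweil : ∀ ι : K →+* ℂ, ‖ι (π : K)‖ = Real.sqrt ((p : ℝ) ^ k₀))
    (hπgen : IntermediateField.adjoin ℚ {(π : K)} = ⊤)
    (L : Type*) [Field L] [NumberField L] [Algebra K L] [IsScalarTower ℚ K L]
    [IsGalois ℚ L]
    (hcardR : Nat.card ((minpoly ℚ (π : K)).rootSet L) = 2 * g)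
    (htransR : ∀ r s : L, r ∈ (minpoly ℚ (π : K)).rootSet L →
      s ∈ (minpoly ℚ (π : K)).rootSet L → ∃ σ : L ≃ₐ[ℚ] L, σ r = s)
    (𝔄 : Ideal (𝓞 L)) (h𝔄max : 𝔄.IsMaximal) (h𝔄p : (p : 𝓞 L) ∈ 𝔄)
    -- the indexing `I : X → R` (with values taken in `𝒪_L`, as all roots are integral)
    (I : X g → 𝓞 L)
    (hIroot : ∀ x : X g, ((I x : L)) ∈ (minpoly ℚ (π : K)).rootSet L)
    (hIbij : ∀ r : L, r ∈ (minpoly ℚ (π : K)).rootSet L → ∃! x : X g, (I x : L) = r)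
    (hIconj : ∀ i : Fin g, (I (Sum.inl i) : L) * (I (Sum.inr i) : L) = (p : L) ^ k₀)
    (hImono : ∀ i j : Fin g, i ≤ j →
      multIdx 𝔄 (Ideal.span {I (Sum.inl i)}) ≤ multIdx 𝔄 (Ideal.span {I (Sum.inl j)}) ∧
      2 * multIdx 𝔄 (Ideal.span {I (Sum.inl j)}) ≤
        multIdx 𝔄 (Ideal.span {(p : 𝓞 L) ^ k₀}))
    -- the `G`-action on `R` transported to `X` through the indexing `I`
    (θ : (L ≃ₐ[ℚ] L) →* Equiv.Perm (X g)) (hθinj : Function.Injective θ)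
    (hθcomp : ∀ (σ : L ≃ₐ[ℚ] L) (x : X g), (I (θ σ x) : L) = σ (I x : L))
    (hθW : θ.range ≤ Wgrp g) (hθc : conjPerm g ∈ θ.range)
    (hθtrans : ∀ x y : X g, ∃ σ' ∈ θ.range, σ' x = y)
    -- the associated wpr `ρ = (w, G)`, with `w = v ∘ I`, is geometrically simple
    (hsimple : GeomSimple
      (fun x : X g => (multIdx 𝔄 (Ideal.span {I x}) : ℚ) /
        (multIdx 𝔄 (Ideal.span {(p : 𝓞 L) ^ k₀}) : ℚ))
      θ.range (Sum.inl ⟨0, hg⟩)) :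
    IsExceptional
      (fun x : X g => (multIdx 𝔄 (Ideal.span {I x}) : ℚ) /
        (multIdx 𝔄 (Ideal.span {(p : 𝓞 L) ^ k₀}) : ℚ))
      θ.range ↔
    ∃ Tp Tm : Finset (Fin g), Disjoint Tp Tm ∧ (Tp ∪ Tm).Nonempty ∧
      Even (Tp.card + Tm.card) ∧
      ∃ ζ : L, (∃ m : ℕ, 1 ≤ m ∧ ζ ^ m = 1) ∧
        ∏ i ∈ Tp, (I (Sum.inl i) : L) =
          ζ * ((p : L) ^ k₀) ^ (((Tp.card : ℤ) - (Tm.card : ℤ)) / 2) *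
            ∏ j ∈ Tm, (I (Sum.inl j) : L) := by
  have hq0 : (p : 𝓞 L) ^ k₀ ≠ 0 := pow_ne_zero _ (by exact_mod_cast hp.ne_zero)
  have hI0 : ∀ x, I x ≠ 0 := by
    have h : ∀ i, I (Sum.inl i) * I (Sum.inr i) ≠ 0 := fun i h0 => by
      have h1 := hIconj i
      rw [← map_mul, h0, map_zero] at h1
      exact pow_ne_zero k₀ (by exact_mod_cast hp.ne_zero) h1.symm
    rintro (i | i)
    exacts [left_ne_zero_of_mul (h i), right_ne_zero_of_mul (h i)]
  have hIp : ∀ P : Ideal (𝓞 L), P.IsPrime → ∀ i, I (Sum.inl i) ∈ P → (p : 𝓞 L) ∈ P := by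
    intro P hP i hi
    refine hP.mem_of_pow_mem k₀ ?_
    rw [show (p : 𝓞 L) ^ k₀ = I (Sum.inl i) * I (Sum.inr i) from
      RingOfIntegers.ext (by simpa using (hIconj i).symm)]
    exact P.mul_mem_right _ hi
  have hnorm : ∀ (φ : L →+* ℂ) (x : X g), ‖φ (I x : L)‖ = Real.sqrt ((p : ℝ) ^ k₀) := by
    intro φ x
    have hmin : minpoly ℚ (π : K) ≠ 0 := minpoly.ne_zero (Algebra.IsIntegral.isIntegral _)
    obtain ⟨σ, hσ⟩ := htransR (algebraMap K L π) (I x) (by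
      rw [Polynomial.mem_rootSet]
      exact ⟨hmin, by rw [Polynomial.aeval_algebraMap_apply, minpoly.aeval, map_zero]⟩) (hIroot x)
    rw [← hσ]
    exact hπweil ((φ.comp (σ : L →+* L)).comp (algebraMap K L))
  have hθsmul : ∀ (σ : L ≃ₐ[ℚ] L) (x : X g), I (θ σ x) = σ • I x := fun σ x =>
    RingOfIntegers.ext (hθcomp σ x)
  have hv : (0 : ℚ) < multIdx 𝔄 (Ideal.span {(p : 𝓞 L) ^ k₀}) := by
    refine Nat.cast_pos.2 (multIdx_pos h𝔄max.isPrime (by simpa using hq0) ?_)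
    rw [Ideal.span_singleton_le_iff_mem]
    exact Ideal.pow_mem_of_mem _ h𝔄p _ hk₀
  rw [IsExceptional]
  refine exists_congr fun Tp => exists_congr fun Tm => and_congr_right fun _ =>
    and_congr_right fun _ => and_congr_right fun heven => ?_
  obtain ⟨n₁, n₂, hn⟩ : ∃ n₁ n₂ : ℕ, Tp.card + 2 * n₁ = Tm.card + 2 * n₂ := by
    obtain ⟨r, hr⟩ := heven
    exact ⟨Tm.card, r, by omega⟩
  have he : ((Tp.card : ℤ) - Tm.card) / 2 = (n₂ : ℤ) - n₁ := by omega
  have heℚ : ((Tp.card : ℚ) - Tm.card) / 2 = (n₂ : ℚ) - n₁ := by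
    have : (Tp.card : ℚ) + 2 * n₁ = Tm.card + 2 * n₂ := by exact_mod_cast hn
    linarith
  have hne : ∀ (T : Finset (Fin g)) (n : ℕ),
      (∏ i ∈ T, I (Sum.inl i)) * ((p : 𝓞 L) ^ k₀) ^ n ≠ 0 := fun T n =>
    mul_ne_zero (Finset.prod_ne_zero_iff.2 fun i _ => hI0 _) (pow_ne_zero _ hq0)
  have hprime : ∀ (T : Finset (Fin g)) (n : ℕ) (P : Ideal (𝓞 L)), P.IsPrime →
      (∏ i ∈ T, I (Sum.inl i)) * ((p : 𝓞 L) ^ k₀) ^ n ∈ P → (p : 𝓞 L) ∈ P := by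
    intro T n P hP h
    rcases hP.mem_or_mem h with h | h
    · obtain ⟨i, -, hi⟩ := hP.prod_mem_iff.1 h
      exact hIp P hP i hi
    · exact hP.mem_of_pow_mem _ (hP.mem_of_pow_mem _ h)
  have hnormT : ∀ (T : Finset (Fin g)) (n : ℕ) (φ : L →+* ℂ),
      ‖φ (((∏ i ∈ T, I (Sum.inl i)) * ((p : 𝓞 L) ^ k₀) ^ n : 𝓞 L) : L)‖ =
        Real.sqrt ((p : ℝ) ^ k₀) ^ (T.card + 2 * n) := by
    intro T n φ
    rw [pow_add, pow_mul, Real.sq_sqrt (by positivity)]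
    simp [hnorm]
  have hmult : ∀ (T : Finset (Fin g)) (n : ℕ) (σ : L ≃ₐ[ℚ] L),
      multIdx 𝔄 (Ideal.span {σ • ((∏ i ∈ T, I (Sum.inl i)) * ((p : 𝓞 L) ^ k₀) ^ n)}) =
        ∑ i ∈ T, multIdx 𝔄 (Ideal.span {I (θ σ (Sum.inl i))}) +
          n * multIdx 𝔄 (Ideal.span {(p : 𝓞 L) ^ k₀}) := by
    intro T n σ
    rw [← multIdx_span_prod_mul_pow 𝔄 T (fun i => hI0 _) hq0]
    congr 3
    have hσp : σ • (p : 𝓞 L) = p := map_natCast (MulSemiringAction.toRingHom _ (𝓞 L) σ) p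
    simp_rw [smul_mul', smul_pow', hσp, hθsmul, Finset.smul_prod']
  calc _ ↔ ∀ σ : L ≃ₐ[ℚ] L,
        multIdx 𝔄 (Ideal.span {σ • ((∏ i ∈ Tp, I (Sum.inl i)) * ((p : 𝓞 L) ^ k₀) ^ n₁)}) =
        multIdx 𝔄 (Ideal.span {σ • ((∏ i ∈ Tm, I (Sum.inl i)) * ((p : 𝓞 L) ^ k₀) ^ n₂)}) := by
        rw [excId_iff]
        simp only [MonoidHom.mem_range, forall_exists_index, forall_apply_eq_imp_iff, hmult]
        refine forall_congr' fun σ => ?_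
        rw [← Finset.sum_div, ← Finset.sum_div, ← sub_div, heℚ, div_eq_iff hv.ne',
          ← Nat.cast_inj (R := ℚ)]
        push_cast
        constructor <;> intro h <;> linarith
    _ ↔ _ := forall_multIdx_smul_eq_iff_associated hp h𝔄max h𝔄p (hne _ _) (hne _ _)
        (hprime _ _) (hprime _ _)
    _ ↔ _ := associated_iff_exists_root_of_unity (hne _ _) fun φ => by
        rw [hnormT, hnormT, hn]
    _ ↔ _ := by
        refine exists_congr fun ζ => and_congr_right fun _ => ?_
        have hqL : (p : L) ^ k₀ ≠ 0 := pow_ne_zero _ (by exact_mod_cast hp.ne_zero)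
        rw [he, zpow_sub₀ hqL, zpow_natCast, zpow_natCast]
        push_cast
        field_simp
end

section
/- (K3-type, Zarhin.) Let g ≥ 2 and let w be the weight function with w(Sum.inl 0) = 0, w(Sum.inr 0) = 1, and w(x) = 1/2 for every other x ∈ X (the K3-type Newton polygon [0, 1/2, …, 1/2, 1]). Let G be any subgroup of W containing c and acting transitively on X. Then there do not exist disjoint subsets T⁺, T⁻ ⊆ Fin g with T⁺ ∪ T⁻ nonempty and |T⁺| + |T⁻| even satisfying the exceptionality identity for ρ = (w, G); in particular ρ is not exceptional. -/
open scoped BigOperators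

open PaperAux

/-- The coefficient of `σ` in `∑ τ, f τ • τ` is `f σ`. -/
theorem coeff_finsum_smul_of {H : Type*} [Group H] [Finite H] (f : H → ℚ) (σ : H) :
    (∑ᶠ τ : H, f τ • MonoidAlgebra.of ℚ H τ).coeff σ = f σ := by
  classical
  have := Fintype.ofFinite H
  rw [finsum_eq_sum_of_fintype]
  simp [MonoidAlgebra.of_apply, MonoidAlgebra.coeff_sum, Finsupp.finsetSum_apply,
    Finsupp.single_apply]

/-- The exceptionality identity, read off at the coefficient of `σ`. -/
theorem PaperAux.ExcId.sum_sub_half {g : ℕ} {w : X g → ℚ} {G : Subgroup (Equiv.Perm (X g))}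
    {Tp Tm : Finset (Fin g)} (h : ExcId w G Tp Tm) (σ : G) :
    ∑ i ∈ Tp, (w ((σ : Equiv.Perm (X g))⁻¹ (Sum.inl i)) - 1 / 2)
      = ∑ j ∈ Tm, (w ((σ : Equiv.Perm (X g))⁻¹ (Sum.inl j)) - 1 / 2) := by
  have hall : (allSum G).coeff σ = 1 := by
    simpa [allSum] using coeff_finsum_smul_of (fun _ : G => (1 : ℚ)) σ
  have hPhi (x : X g) : (Phi w G x).coeff σ = w ((σ : Equiv.Perm (X g))⁻¹ x) :=
    coeff_finsum_smul_of (fun τ : G => w ((τ : Equiv.Perm (X g))⁻¹ x)) σ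
  have key := congrArg (fun a => a.coeff σ) h
  simp only [MonoidAlgebra.coeff_sub, MonoidAlgebra.coeff_sum, MonoidAlgebra.coeff_smul,
    Finsupp.sub_apply, Finsupp.finsetSum_apply, Finsupp.smul_apply, hPhi, hall,
    smul_eq_mul] at key
  simp only [Finset.sum_sub_distrib, Finset.sum_const, nsmul_eq_mul]
  linarith

/-- K3-type, Zarhin: for the K3-type weight function no pair `(T⁺, T⁻)`
satisfies the exceptionality identity. -/
theorem k3_not_exceptional {g : ℕ} (hg : 2 ≤ g) (w : X g → ℚ)
    (hw0 : w (Sum.inl ⟨0, by omega⟩) = 0) (hw1 : w (Sum.inr ⟨0, by omega⟩) = 1)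
    (hwhalf : ∀ x : X g, x ≠ Sum.inl ⟨0, by omega⟩ → x ≠ Sum.inr ⟨0, by omega⟩ → w x = 1/2)
    (G : Subgroup (Equiv.Perm (X g))) (hGW : G ≤ Wgrp g) (hc : conjPerm g ∈ G)
    (htrans : ∀ x y : X g, ∃ σ ∈ G, σ x = y) :
    ¬ ∃ Tp Tm : Finset (Fin g), Disjoint Tp Tm ∧ (Tp ∪ Tm).Nonempty ∧
        Even (Tp.card + Tm.card) ∧ ExcId w G Tp Tm := by
  rintro ⟨Tp, Tm, hdisj, ⟨k, hk⟩, -, h⟩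
  obtain ⟨σ, hσ, hσk⟩ := htrans (Sum.inl ⟨0, by omega⟩) (Sum.inl k)
  have hσk' : σ (Sum.inr ⟨0, by omega⟩) = Sum.inr k := by
    have hcomm := DFunLike.congr_fun (Subgroup.mem_centralizer_singleton_iff.mp (hGW hσ))
      (Sum.inl ⟨0, by omega⟩)
    simpa [conjPerm, hσk] using hcomm
  have hself : w (σ⁻¹ (Sum.inl k)) - 1 / 2 = -(1 / 2) := by
    rw [Equiv.Perm.inv_eq_iff_eq.mpr hσk.symm, hw0]
    norm_num
  have hother (i : Fin g) (hi : i ≠ k) : w (σ⁻¹ (Sum.inl i)) - 1 / 2 = 0 := by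
    rw [hwhalf, sub_self]
    · rw [Ne, Equiv.Perm.inv_eq_iff_eq, hσk]
      simpa using hi
    · rw [Ne, Equiv.Perm.inv_eq_iff_eq, hσk']
      simp
  have hmem (T : Finset (Fin g)) (hT : k ∈ T) :
      ∑ i ∈ T, (w (σ⁻¹ (Sum.inl i)) - 1 / 2) = -(1 / 2) := by
    rw [Finset.sum_eq_single_of_mem k hT fun i _ hi => hother i hi, hself]
  have hnotMem (T : Finset (Fin g)) (hT : k ∉ T) :
      ∑ i ∈ T, (w (σ⁻¹ (Sum.inl i)) - 1 / 2) = 0 :=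
    Finset.sum_eq_zero fun i hi => hother i (ne_of_mem_of_not_mem hi hT)
  have key := h.sum_sub_half ⟨σ, hσ⟩
  rcases Finset.mem_union.mp hk with hp | hm
  · rw [hmem Tp hp, hnotMem Tm (Finset.disjoint_left.mp hdisj hp)] at key
    norm_num at key
  · rw [hmem Tm hm, hnotMem Tp (Finset.disjoint_right.mp hdisj hm)] at key
    norm_num at key
end

section
/- (Lenstra–Zarhin.) Let g ≥ 2 and let w : X → ℚ be a weight function such that exactly two elements x of X have w(x) = 1/2 and every other value of w has odd denominator. Let G be any subgroup of W containing c and acting transitively on X. Then there do not exist disjoint subsets T⁺, T⁻ ⊆ Fin g with T⁺ ∪ T⁻ nonempty and |T⁺| + |T⁻| even satisfying the exceptionality identity for ρ = (w, G); in particular ρ is not exceptional. -/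
open scoped BigOperators

open PaperAux

namespace PaperAux

lemma Phi_apply {g : ℕ} (w : X g → ℚ) (G : Subgroup (Equiv.Perm (X g))) (x : X g) (σ : G) :
    (Phi w G x).coeff σ = w ((σ : Equiv.Perm (X g))⁻¹ x) := by
  classical
  have : Fintype G := Fintype.ofFinite G
  rw [Phi, finsum_eq_sum_of_fintype]
  simp [MonoidAlgebra.of_apply, Finsupp.single_apply]

lemma allSum_apply {g : ℕ} (G : Subgroup (Equiv.Perm (X g))) (σ : G) :
    (allSum G).coeff σ = 1 := by
  classical
  have : Fintype G := Fintype.ofFinite G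
  rw [allSum, finsum_eq_sum_of_fintype]
  simp [MonoidAlgebra.of_apply, Finsupp.single_apply]

/-- The exceptionality identity, read off at the coefficient of `σ`. -/
lemma ExcId.coeff_eq {g : ℕ} {w : X g → ℚ} {G : Subgroup (Equiv.Perm (X g))}
    {Tp Tm : Finset (Fin g)} (h : ExcId w G Tp Tm) (σ : G) :
    (∑ i ∈ Tp, w ((σ : Equiv.Perm (X g))⁻¹ (Sum.inl i)))
      - (∑ j ∈ Tm, w ((σ : Equiv.Perm (X g))⁻¹ (Sum.inl j)))
      = ((Tp.card : ℚ) - (Tm.card : ℚ)) / 2 := by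
  have h' := congrArg (fun a : MonoidAlgebra ℚ G => a.coeff σ) h
  simpa [Phi_apply, allSum_apply, Finsupp.finsetSum_apply] using h'

lemma odd_den_add {a b : ℚ} (ha : Odd a.den) (hb : Odd b.den) : Odd (a + b).den :=
  (ha.mul hb).of_dvd_nat (Rat.add_den_dvd a b)

lemma odd_den_sub {a b : ℚ} (ha : Odd a.den) (hb : Odd b.den) : Odd (a - b).den := by
  rw [sub_eq_add_neg]
  exact odd_den_add ha (by simpa using hb)

lemma odd_den_sum {ι : Type*} {s : Finset ι} {f : ι → ℚ} (h : ∀ i ∈ s, Odd (f i).den) :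
    Odd (∑ i ∈ s, f i).den :=
  Finset.sum_induction f (fun q => Odd q.den) (fun _ _ => odd_den_add) (by simp) h

lemma not_odd_den_half : ¬ Odd (1 / 2 : ℚ).den := by
  norm_num

lemma conjPerm_ne {g : ℕ} (x : X g) : conjPerm g x ≠ x := by
  cases x <;> simp [conjPerm]

lemma IsWeightFn.add_conj {g : ℕ} {w : X g → ℚ} (hw : IsWeightFn g w) (x : X g) :
    w x + w (conjPerm g x) = 1 := by
  cases x with
  | inl i => exact hw.add_one i
  | inr i => rw [add_comm]; exact hw.add_one i

/-- If only two symbols have weight `1/2`, they are conjugate to each other. -/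
lemma IsWeightFn.eq_or_eq_conj_of_half {g : ℕ} {w : X g → ℚ} (hw : IsWeightFn g w)
    (hhalf : (Finset.univ.filter fun x : X g => w x = 1 / 2).card = 2)
    {x y : X g} (hx : w x = 1 / 2) (hy : w y = 1 / 2) : y = x ∨ y = conjPerm g x := by
  have hcx : w (conjPerm g x) = 1 / 2 := by linarith [hw.add_conj x]
  have hsub : ({x, conjPerm g x} : Finset (X g)) ⊆
      Finset.univ.filter fun x : X g => w x = 1 / 2 := by
    intro z hz
    rcases Finset.mem_insert.1 hz with rfl | hz
    · simpa using hx
    · rw [Finset.mem_singleton.1 hz]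
      simpa using hcx
  have heq := Finset.eq_of_subset_of_card_le hsub
    (by rw [hhalf, Finset.card_pair (conjPerm_ne x).symm])
  have hmem : y ∈ ({x, conjPerm g x} : Finset (X g)) := by
    rw [heq]
    simpa using hy
  simpa using hmem

end PaperAux

/-- Lenstra–Zarhin: if exactly two symbols have weight `1/2` and all other
weights have odd denominator, then no pair `(T⁺, T⁻)` satisfies the exceptionality identity. -/
theorem lenstra_zarhin_not_exceptional {g : ℕ} (hg : 2 ≤ g) (w : X g → ℚ)
    (hw : IsWeightFn g w)
    (hhalf : (Finset.univ.filter fun x : X g => w x = 1/2).card = 2)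
    (hden : ∀ x : X g, w x ≠ 1/2 → Odd (w x).den)
    (G : Subgroup (Equiv.Perm (X g))) (hGW : G ≤ Wgrp g) (hc : conjPerm g ∈ G)
    (htrans : ∀ x y : X g, ∃ σ ∈ G, σ x = y) :
    ¬ ∃ Tp Tm : Finset (Fin g), Disjoint Tp Tm ∧ (Tp ∪ Tm).Nonempty ∧
        Even (Tp.card + Tm.card) ∧ ExcId w G Tp Tm := by
  rintro ⟨Tp, Tm, hdisj, ⟨t, ht⟩, heven, hexc⟩
  obtain ⟨h, hh⟩ := Finset.card_pos.1 (hhalf ▸ Nat.two_pos)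
  replace hh : w h = 1 / 2 := by simpa using hh
  obtain ⟨σ, hσ, hσh⟩ := htrans h (Sum.inl t)
  have hσt : σ⁻¹ (Sum.inl t) = h := by rw [← hσh]; simp
  have hodd : ∀ i, i ≠ t → Odd (w (σ⁻¹ (Sum.inl i))).den := by
    refine fun i hi => hden _ fun hiw => ?_
    rcases hw.eq_or_eq_conj_of_half hhalf hh hiw with h1 | h1
    · rw [Equiv.Perm.inv_eq_iff_eq, hσh] at h1
      exact hi (Sum.inl_injective h1)
    · have hcomm : σ (conjPerm g h) = conjPerm g (σ h) :=
        (DFunLike.congr_fun (Subgroup.mem_centralizer_singleton_iff.1 (hGW hσ)) h)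
      rw [Equiv.Perm.inv_eq_iff_eq, hcomm, hσh] at h1
      simp [conjPerm] at h1
  have hint : Odd (((Tp.card : ℚ) - (Tm.card : ℚ)) / 2).den := by
    obtain ⟨r, hr⟩ := heven
    have hr' : (Tp.card : ℚ) + Tm.card = r + r := by exact_mod_cast hr
    have : ((Tp.card : ℚ) - (Tm.card : ℚ)) / 2 = ((r - Tm.card : ℤ) : ℚ) := by
      push_cast
      linarith
    rw [this, Rat.den_intCast]
    exact odd_one
  have key := hexc.coeff_eq ⟨σ, hσ⟩
  simp only at key
  have hsum : ∀ s : Finset (Fin g), Odd (∑ i ∈ s.erase t, w (σ⁻¹ (Sum.inl i))).den :=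
    fun s => odd_den_sum fun i hi => hodd i (Finset.ne_of_mem_erase hi)
  have hwt : w (σ⁻¹ (Sum.inl t)) = 1 / 2 := by rw [hσt, hh]
  apply not_odd_den_half
  rcases Finset.mem_union.1 ht with htp | htm
  · have hm := hsum Tm
    rw [Finset.erase_eq_of_notMem (Finset.disjoint_left.1 hdisj htp)] at hm
    rw [← Finset.add_sum_erase Tp _ htp, hwt] at key
    convert odd_den_add (odd_den_sub hint (hsum Tp)) hm using 2
    linarith
  · have hp := hsum Tp
    rw [Finset.erase_eq_of_notMem (Finset.disjoint_right.1 hdisj htm)] at hp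
    rw [← Finset.add_sum_erase Tm _ htm, hwt] at key
    convert odd_den_sub (odd_den_sub hp hint) (hsum Tm) using 2
    linarith
end
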